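/- Let (θ_j^{(5)})_{j≥0} be the DOC kernels associated with the BDF-5 kernels. Then the decaying estimate |θ_j^{(5)}| ≤ (24/5)·(5/7)^j holds for all j ≥ 0. -/

import Mathlib

noncomputable def bdf5 : ℕ → ℝ
  | 0 => 137/60
  | 1 => -(163/60)
  | 2 => 137/60
  | 3 => -(21/20)
  | 4 => 1/5
  | _ => 0

/-- The DOC kernels associated with kernels `b`:
`θ₀ = 1/b₀` and `θ_j = -(1/b₀) * ∑_{s=1}^{j} θ_{j-s} b_s` for `j ≥ 1`. -/
noncomputable def doc (b : ℕ → ℝ) : ℕ → ℝ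
  | 0 => 1 / b 0
  | j+1 => -(1 / b 0) * ∑ s ∈ (Finset.Icc 1 (j+1)).attach, doc b ((j+1) - s.1) * b s.1
  decreasing_by
    have h := Finset.mem_Icc.mp s.2
    omega

/-- From index `4` on, the BDF-5 DOC kernels satisfy a four-term linear recursion. -/
lemma doc_bdf5_add_four (n : ℕ) :
    doc bdf5 (n + 4) = 163/137 * doc bdf5 (n + 3) - doc bdf5 (n + 2)
      + 63/137 * doc bdf5 (n + 1) - 12/137 * doc bdf5 n := by
  have hsum : ∑ s ∈ Finset.Icc 1 (n + 4), doc bdf5 (n + 4 - s) * bdf5 s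
      = ∑ s ∈ Finset.Icc 1 4, doc bdf5 (n + 4 - s) * bdf5 s := by
    symm
    apply Finset.sum_subset
    · exact Finset.Icc_subset_Icc_right (by omega)
    · intro s hs hs'
      simp only [Finset.mem_Icc] at hs hs'
      obtain ⟨k, rfl⟩ : ∃ k, s = k + 5 := ⟨s - 5, by omega⟩
      simp [bdf5]
  have hIcc : Finset.Icc 1 4 = ({1, 2, 3, 4} : Finset ℕ) := by decide
  rw [doc, Finset.sum_attach (Finset.Icc 1 (n + 3 + 1))
    (fun s => doc bdf5 (n + 3 + 1 - s) * bdf5 s), hsum, hIcc]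
  simp [bdf5]
  ring

/-- A quadratic Lyapunov function for the BDF-5 recursion. -/
noncomputable def lyapunov (a b c d : ℝ) : ℝ :=
  10 * a^2 + 2167/10 * b^2 + 7873/10 * c^2 + 1149/2 * d^2 - 414/5 * a * b + 652/5 * a * c
    - 46 * a * d - 3782/5 * b * c + 1949/5 * b * d - 1099 * c * d

lemma sq_le_lyapunov (a b c d : ℝ) : a^2 ≤ lyapunov a b c d := by
  unfold lyapunov
  nlinarith [sq_nonneg (a - 23/5 * b + 326/45 * c - 23/9 * d),
    sq_nonneg (b - 2.981 * c + 3.393 * d), sq_nonneg (c - 1.437 * d),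
    sq_nonneg c, sq_nonneg d, sq_nonneg (b + c), sq_nonneg (b - c), sq_nonneg (b + d),
    sq_nonneg (b - d), sq_nonneg (c + d), sq_nonneg (c - d)]

lemma lyapunov_step (a b c d : ℝ) :
    lyapunov b c d (163/137 * d - c + 63/137 * b - 12/137 * a) ≤ 25/49 * lyapunov a b c d := by
  unfold lyapunov
  nlinarith [sq_nonneg (a + 0.005 * b + 0.023 * c + 0.007 * d),
    sq_nonneg (b + 0.006 * c - 0.133 * d), sq_nonneg (c - 0.057 * d), sq_nonneg d,
    sq_nonneg a, sq_nonneg b, sq_nonneg c, sq_nonneg (a + b), sq_nonneg (a - b),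
    sq_nonneg (a + c), sq_nonneg (a - c), sq_nonneg (a + d), sq_nonneg (a - d),
    sq_nonneg (b + c), sq_nonneg (b - c), sq_nonneg (b + d), sq_nonneg (b - d),
    sq_nonneg (c + d), sq_nonneg (c - d)]

lemma lyapunov_doc_bdf5_zero :
    lyapunov (doc bdf5 0) (doc bdf5 1) (doc bdf5 2) (doc bdf5 3) ≤ (24/5)^2 := by
  have hdoc (n : ℕ) : doc bdf5 (n + 1)
      = -(60/137) * ∑ s ∈ Finset.Icc 1 (n + 1), doc bdf5 (n + 1 - s) * bdf5 s := by
    rw [doc, Finset.sum_attach (Finset.Icc 1 (n + 1))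
      (fun s => doc bdf5 (n + 1 - s) * bdf5 s)]
    norm_num [bdf5]
  have h0 : doc bdf5 0 = 60/137 := by norm_num [doc, bdf5]
  have h1 : doc bdf5 1 = 163/137 * (60/137) := by
    rw [hdoc 0]
    norm_num [h0, bdf5]
  have h2 : doc bdf5 2 = 163/137 * doc bdf5 1 - 60/137 := by
    rw [hdoc 1, show Finset.Icc 1 (1 + 1) = ({1, 2} : Finset ℕ) by decide]
    norm_num [h0, h1, bdf5]
  have h3 : doc bdf5 3 = 163/137 * doc bdf5 2 - doc bdf5 1 + 63/137 * (60/137) := by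
    rw [hdoc 2, show Finset.Icc 1 (2 + 1) = ({1, 2, 3} : Finset ℕ) by decide]
    norm_num [h0, h1, h2, bdf5]
  rw [h3, h2, h1, h0]
  norm_num [lyapunov]

lemma lyapunov_doc_bdf5_le (n : ℕ) :
    lyapunov (doc bdf5 n) (doc bdf5 (n + 1)) (doc bdf5 (n + 2)) (doc bdf5 (n + 3))
      ≤ (24/5)^2 * (25/49)^n := by
  induction n with
  | zero => simpa using lyapunov_doc_bdf5_zero
  | succ n ih =>
    have h := lyapunov_step (doc bdf5 n) (doc bdf5 (n + 1)) (doc bdf5 (n + 2)) (doc bdf5 (n + 3))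
    rw [← doc_bdf5_add_four] at h
    calc _ ≤ _ := h
      _ ≤ 25/49 * ((24/5)^2 * (25/49)^n) := by gcongr
      _ = _ := by ring

theorem doc_bdf5_decay (j : ℕ) : |doc bdf5 j| ≤ 24/5 * (5/7)^j := by
  apply abs_le_of_sq_le_sq _ (by positivity)
  calc (doc bdf5 j)^2 ≤ _ := sq_le_lyapunov _ _ _ _
    _ ≤ (24/5)^2 * (25/49)^j := lyapunov_doc_bdf5_le j
    _ = (24/5 * (5/7)^j)^2 := by
      rw [mul_pow, ← pow_mul, mul_comm j 2, pow_mul]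
      norm_num
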